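/- arXiv:2605.24819 — 2 statements merged into one kernel-verified Lean document; each statement's English description precedes it below -/
import Mathlib

section
/- Let P ∈ ℝ^{d×n} be a Haar–Stiefel matrix with 2 ≤ d ≤ n−1, let e₁, e₂ ∈ ℝⁿ be orthonormal vectors, and let D := ‖Pe₁‖²·‖Pe₂‖² − ⟨Pe₁, Pe₂⟩² be the determinant of the projected 2×2 Gram matrix. Then E[D] = d(d−1)/(n(n−1)), E[D²] = (d(d+2)/(n(n+2)))·((d−1)(d+1)/((n−1)(n+1))), and E[D²]/E[D]² = ((d+2)(d+1)/(d(d−1)))·(n(n−1)/((n+2)(n+1))) ≤ 6. -/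
open MeasureTheory Matrix

/-- Measurable space structure on real matrices (as a pi type). -/
instance {d n : ℕ} : MeasurableSpace (Matrix (Fin d) (Fin n) ℝ) :=
  inferInstanceAs (MeasurableSpace (Fin d → Fin n → ℝ))

/-- Euclidean inner product on `m → ℝ`. -/
noncomputable def dotR {m : Type*} [Fintype m] (x y : m → ℝ) : ℝ := ∑ i, x i * y i

/-- Euclidean norm on `m → ℝ`. -/
noncomputable def norR {m : Type*} [Fintype m] (x : m → ℝ) : ℝ := Real.sqrt (dotR x x)

/-- The section-efficiency ratio Γ(P;u,v) = (‖Pu‖‖Pv‖ − ⟨Pu,Pv⟩)/(1 − ⟨u,v⟩). -/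
noncomputable def Gam {d n : ℕ} (P : Matrix (Fin d) (Fin n) ℝ) (u v : Fin n → ℝ) : ℝ :=
  (norR (P.mulVec u) * norR (P.mulVec v) - dotR (P.mulVec u) (P.mulVec v)) / (1 - dotR u v)

/-- `μ` is the Haar–Stiefel distribution: a probability measure supported on the
Stiefel manifold `{P : P Pᵀ = I_d}` that is invariant under right multiplication
by any orthogonal matrix.  (This characterizes the law of the first `d` rows of a
Haar-distributed orthogonal matrix.) -/
def IsHaarStiefel {d n : ℕ} (μ : Measure (Matrix (Fin d) (Fin n) ℝ)) : Prop :=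
  IsProbabilityMeasure μ ∧
  (∀ᵐ P ∂μ, P * Pᵀ = 1) ∧
  ∀ Q : Matrix (Fin n) (Fin n) ℝ, Q ∈ Matrix.orthogonalGroup (Fin n) ℝ →
    μ.map (fun P => P * Q) = μ


/-- The projected Gram determinant. -/
noncomputable def GD {d n : ℕ} (P : Matrix (Fin d) (Fin n) ℝ) (u v : Fin n → ℝ) : ℝ :=
  dotR (P.mulVec u) (P.mulVec u) * dotR (P.mulVec v) (P.mulVec v) -
          dotR (P.mulVec u) (P.mulVec v) ^ 2

/-- Second order trace functional. -/
noncomputable def LA {n : ℕ} (f : (Fin n → ℝ) → ℝ) : ℝ := ∑ i, f (Pi.single i 1)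

/-- Fourth order (Gaussian-like) functional. -/
noncomputable def LB {n : ℕ} (f : (Fin n → ℝ) → ℝ) : ℝ :=
  ∑ i, ∑ j, (1 / 4 : ℝ) * (f (Pi.single i 1 + Pi.single j 1) + f (Pi.single i 1 - Pi.single j 1)
    - 2 * f (Pi.single i 1) - 2 * f (Pi.single j 1))

lemma dotR_eq {m : Type*} [Fintype m] (x y : m → ℝ) : dotR x y = x ⬝ᵥ y := rfl

lemma LA_quad {n : ℕ} (A : Matrix (Fin n) (Fin n) ℝ) :
    LA (fun u => u ⬝ᵥ A *ᵥ u) = A.trace := by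
  simp [LA, Matrix.trace]

lemma LB_quad {n : ℕ} (A : Matrix (Fin n) (Fin n) ℝ) (hA : Aᵀ = A) :
    LB (fun u => (u ⬝ᵥ A *ᵥ u) ^ 2) = A.trace ^ 2 + 2 * (A * A).trace := by
  have h : ∀ i j, A j i = A i j := fun i j => by
    conv_rhs => rw [← hA]
    rfl
  have h1 : A.trace ^ 2 = ∑ i, ∑ j, A i i * A j j := by
    rw [sq, Matrix.trace, Finset.sum_mul_sum]; rfl
  have h2 : 2 * (A * A).trace = ∑ i, ∑ j, 2 * (A i j * A j i) := by
    simp [Matrix.trace, Matrix.mul_apply, Finset.mul_sum]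
  rw [h1, h2, ← Finset.sum_add_distrib, LB]
  refine Finset.sum_congr rfl fun i _ => ?_
  rw [← Finset.sum_add_distrib]
  refine Finset.sum_congr rfl fun j _ => ?_
  simp [Matrix.mulVec_add, Matrix.mulVec_sub]
  rw [h i j]
  ring

lemma PtP {d n : ℕ} (P : Matrix (Fin d) (Fin n) ℝ) (x y : Fin n → ℝ) :
    (P *ᵥ x) ⬝ᵥ (P *ᵥ y) = x ⬝ᵥ ((Pᵀ * P) *ᵥ y) := by
  rw [← Matrix.mulVec_mulVec, Matrix.dotProduct_mulVec x, Matrix.vecMul_transpose]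

/-- The matrix of the quadratic form `u ↦ GD P u v`. -/
noncomputable def AV {d n : ℕ} (P : Matrix (Fin d) (Fin n) ℝ) (v : Fin n → ℝ) :
    Matrix (Fin n) (Fin n) ℝ :=
  ((P *ᵥ v) ⬝ᵥ (P *ᵥ v)) • (Pᵀ * P) - Matrix.vecMulVec ((Pᵀ * P) *ᵥ v) ((Pᵀ * P) *ᵥ v)

lemma GD_quad {d n : ℕ} (P : Matrix (Fin d) (Fin n) ℝ) (u v : Fin n → ℝ) :
    GD P u v = u ⬝ᵥ (AV P v) *ᵥ u := by
  simp only [GD, AV, dotR_eq, Matrix.sub_mulVec, Matrix.smul_mulVec, dotProduct_sub,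
    dotProduct_smul, Matrix.vecMulVec_mulVec, PtP P u, op_smul_eq_smul, smul_eq_mul]
  rw [dotProduct_comm ((Pᵀ * P) *ᵥ v) u]
  ring

lemma AV_symm {d n : ℕ} (P : Matrix (Fin d) (Fin n) ℝ) (v : Fin n → ℝ) :
    (AV P v)ᵀ = AV P v := by
  simp [AV, Matrix.transpose_mul, Matrix.transpose_vecMulVec]

lemma PtP_idem {d n : ℕ} {P : Matrix (Fin d) (Fin n) ℝ} (hP : P * Pᵀ = 1) :
    (Pᵀ * P) * (Pᵀ * P) = Pᵀ * P := by
  rw [Matrix.mul_assoc, ← Matrix.mul_assoc P, hP, Matrix.one_mul]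

lemma PtP_trace {d n : ℕ} {P : Matrix (Fin d) (Fin n) ℝ} (hP : P * Pᵀ = 1) :
    (Pᵀ * P).trace = d := by
  rw [Matrix.trace_mul_comm, hP]; simp

lemma w_norm {d n : ℕ} {P : Matrix (Fin d) (Fin n) ℝ} (hP : P * Pᵀ = 1) (v : Fin n → ℝ) :
    ((Pᵀ * P) *ᵥ v) ⬝ᵥ ((Pᵀ * P) *ᵥ v) = (P *ᵥ v) ⬝ᵥ (P *ᵥ v) := by
  rw [PtP P v v, PtP (Pᵀ * P) v v, Matrix.transpose_mul, Matrix.transpose_transpose, PtP_idem hP]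

lemma AV_trace {d n : ℕ} {P : Matrix (Fin d) (Fin n) ℝ} (hP : P * Pᵀ = 1) (v : Fin n → ℝ) :
    (AV P v).trace = ((P *ᵥ v) ⬝ᵥ (P *ᵥ v)) * ((d : ℝ) - 1) := by
  simp only [AV, Matrix.trace_sub, Matrix.trace_smul, Matrix.trace_vecMulVec, PtP_trace hP,
    w_norm hP, smul_eq_mul]
  ring

lemma AV_trace_sq {d n : ℕ} {P : Matrix (Fin d) (Fin n) ℝ} (hP : P * Pᵀ = 1) (v : Fin n → ℝ) :
    (AV P v * AV P v).trace = ((P *ᵥ v) ⬝ᵥ (P *ᵥ v)) ^ 2 * ((d : ℝ) - 1) := by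
  have hs : (Pᵀ * P)ᵀ = Pᵀ * P := by simp
  have hw : (Pᵀ * P) *ᵥ ((Pᵀ * P) *ᵥ v) = (Pᵀ * P) *ᵥ v := by
    rw [Matrix.mulVec_mulVec, PtP_idem hP]
  have hw2 : ((Pᵀ * P) *ᵥ v) ᵥ* (Pᵀ * P) = (Pᵀ * P) *ᵥ v := by
    conv_lhs => rw [← hs, Matrix.vecMul_transpose, hs, hw]
  simp only [AV, Matrix.sub_mul, Matrix.mul_sub, Matrix.smul_mul, Matrix.mul_smul, PtP_idem hP,
    Matrix.mul_vecMulVec, Matrix.vecMulVec_mul, hw, hw2,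
    Matrix.trace_sub, Matrix.trace_smul, Matrix.trace_vecMulVec, PtP_trace hP,
    w_norm hP, smul_eq_mul, Matrix.sub_mulVec, Matrix.smul_mulVec, Matrix.vecMulVec_mulVec,
    op_smul_eq_smul, sub_dotProduct, smul_dotProduct]
  ring

lemma LA_smul {n : ℕ} (f : (Fin n → ℝ) → ℝ) (c : ℝ) : LA (fun u => c * f u) = c * LA f := by
  simp [LA, Finset.mul_sum]

lemma LB_smul {n : ℕ} (f : (Fin n → ℝ) → ℝ) (c : ℝ) : LB (fun u => c * f u) = c * LB f := by
  simp only [LB, Finset.mul_sum]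
  refine Finset.sum_congr rfl fun i _ => Finset.sum_congr rfl fun j _ => ?_
  ring

lemma LA_GD {d n : ℕ} {P : Matrix (Fin d) (Fin n) ℝ} (hP : P * Pᵀ = 1) :
    LA (fun v => LA (fun u => GD P u v)) = (d : ℝ) * (d - 1) := by
  simp only [GD_quad, LA_quad, AV_trace hP]
  simp only [mul_comm _ ((d : ℝ) - 1), LA_smul, PtP, LA_quad, PtP_trace hP]

lemma LB_GD {d n : ℕ} {P : Matrix (Fin d) (Fin n) ℝ} (hP : P * Pᵀ = 1) :
    LB (fun v => LB (fun u => GD P u v ^ 2)) = (d : ℝ) * (d + 2) * ((d - 1) * (d + 1)) := by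
  have h : ∀ v, LB (fun u => GD P u v ^ 2) =
      (((d : ℝ) - 1) * (d + 1)) * (v ⬝ᵥ (Pᵀ * P) *ᵥ v) ^ 2 := by
    intro v
    simp only [GD_quad]
    rw [LB_quad _ (AV_symm P v), AV_trace hP, AV_trace_sq hP, ← PtP]
    ring
  simp only [h, LB_smul]
  rw [LB_quad _ (by simp), PtP_idem hP, PtP_trace hP]
  ring

lemma LA_int {Ω : Type*} [MeasurableSpace Ω] (μ : Measure Ω) {n : ℕ}
    (F : Ω → (Fin n → ℝ) → ℝ) (h : ∀ u, Integrable (fun P => F P u) μ) :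
    Integrable (fun P => LA (F P)) μ ∧ ∫ P, LA (F P) ∂μ = LA (fun u => ∫ P, F P u ∂μ) := by
  simp only [LA]
  refine ⟨integrable_finsetSum _ fun i _ => h _, integral_finsetSum _ fun i _ => h _⟩

lemma LB_int {Ω : Type*} [MeasurableSpace Ω] (μ : Measure Ω) {n : ℕ}
    (F : Ω → (Fin n → ℝ) → ℝ) (h : ∀ u, Integrable (fun P => F P u) μ) :
    Integrable (fun P => LB (F P)) μ ∧ ∫ P, LB (F P) ∂μ = LB (fun u => ∫ P, F P u ∂μ) := by
  simp only [LB]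
  have h3 : ∀ i j : Fin n, Integrable (fun P => (F P (Pi.single i 1 + Pi.single j 1)
      + F P (Pi.single i 1 - Pi.single j 1)
      - 2 * F P (Pi.single i 1) - 2 * F P (Pi.single j 1))) μ := fun i j =>
    (((h _).add (h _)).sub ((h _).const_mul 2)).sub ((h _).const_mul 2)
  have h4 := fun i j => (h3 i j).const_mul (1 / 4 : ℝ)
  refine ⟨integrable_finsetSum _ fun i _ => integrable_finsetSum _ fun j _ => h4 i j, ?_⟩
  rw [integral_finsetSum _ fun i _ => integrable_finsetSum _ fun j _ => h4 i j]
  refine Finset.sum_congr rfl fun i _ => ?_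
  rw [integral_finsetSum _ fun j _ => h4 i j]
  refine Finset.sum_congr rfl fun j _ => ?_
  have k1 : Integrable (fun P => F P (Pi.single i 1 + Pi.single j 1)
      + F P (Pi.single i 1 - Pi.single j 1)) μ := (h _).add (h _)
  have k2 : Integrable (fun P => F P (Pi.single i 1 + Pi.single j 1)
      + F P (Pi.single i 1 - Pi.single j 1) - 2 * F P (Pi.single i 1)) μ :=
    k1.sub ((h _).const_mul 2)
  rw [integral_const_mul, integral_sub k2 ((h _).const_mul 2),
    integral_sub k1 ((h _).const_mul 2),
    integral_add (h _) (h _), integral_const_mul, integral_const_mul]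

lemma meas_entry {d n : ℕ} (i : Fin d) (j : Fin n) :
    Measurable (fun P : Matrix (Fin d) (Fin n) ℝ => P i j) :=
  (measurable_pi_apply j).comp (measurable_pi_apply (X := fun _ : Fin d => Fin n → ℝ) i)

lemma meas_GD {d n : ℕ} (u v : Fin n → ℝ) :
    Measurable (fun P : Matrix (Fin d) (Fin n) ℝ => GD P u v) := by
  have h : ∀ (w : Fin n → ℝ) (i : Fin d),
      Measurable (fun P : Matrix (Fin d) (Fin n) ℝ => (P *ᵥ w) i) := by
    intro w i
    simp only [Matrix.mulVec, dotProduct]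
    exact Finset.measurable_sum _ fun j _ => (meas_entry i j).mul_const _
  have h2 : ∀ (w z : Fin n → ℝ),
      Measurable (fun P : Matrix (Fin d) (Fin n) ℝ => dotR (P *ᵥ w) (P *ᵥ z)) := fun w z =>
    Finset.measurable_sum _ fun j _ => (h w j).mul (h z j)
  exact ((h2 u u).mul (h2 v v)).sub ((h2 u v).pow_const 2)

lemma meas_mul {d n : ℕ} (Q : Matrix (Fin n) (Fin n) ℝ) :
    Measurable (fun P : Matrix (Fin d) (Fin n) ℝ => P * Q) := by
  refine measurable_pi_lambda (X := fun _ : Fin d => Fin n → ℝ) _ fun i =>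
    measurable_pi_lambda _ fun j => ?_
  simp only [Matrix.mul_apply]
  exact Finset.measurable_sum _ fun k _ => (meas_entry i k).mul_const _

lemma nrm_le {d n : ℕ} {P : Matrix (Fin d) (Fin n) ℝ} (hP : P * Pᵀ = 1) (u : Fin n → ℝ) :
    (P *ᵥ u) ⬝ᵥ (P *ᵥ u) ≤ u ⬝ᵥ u := by
  have h : 0 ≤ (u - (Pᵀ * P) *ᵥ u) ⬝ᵥ (u - (Pᵀ * P) *ᵥ u) :=
    Finset.sum_nonneg fun i _ => mul_self_nonneg _
  rw [sub_dotProduct, dotProduct_sub, dotProduct_sub, w_norm hP,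
    dotProduct_comm ((Pᵀ * P) *ᵥ u) u, ← PtP] at h
  linarith

lemma GD_nonneg {d n : ℕ} (P : Matrix (Fin d) (Fin n) ℝ) (u v : Fin n → ℝ) : 0 ≤ GD P u v := by
  have := Finset.sum_mul_sq_le_sq_mul_sq Finset.univ (P *ᵥ u) (P *ᵥ v)
  simp only [GD, dotR]
  simp only [sq] at this ⊢
  linarith

lemma GD_le {d n : ℕ} {P : Matrix (Fin d) (Fin n) ℝ} (hP : P * Pᵀ = 1) (u v : Fin n → ℝ) :
    GD P u v ≤ (u ⬝ᵥ u) * (v ⬝ᵥ v) := by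
  have h1 : (P *ᵥ u) ⬝ᵥ (P *ᵥ u) * (P *ᵥ v) ⬝ᵥ (P *ᵥ v) ≤ (u ⬝ᵥ u) * (v ⬝ᵥ v) :=
    mul_le_mul (nrm_le hP u) (nrm_le hP v) (Finset.sum_nonneg fun i _ => mul_self_nonneg _)
      (Finset.sum_nonneg fun i _ => mul_self_nonneg _)
  simp only [GD, dotR_eq]
  nlinarith [sq_nonneg ((P *ᵥ u) ⬝ᵥ (P *ᵥ v))]

lemma GD_int {d n : ℕ} (μ : Measure (Matrix (Fin d) (Fin n) ℝ)) (hμ : IsHaarStiefel μ)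
    (k : ℕ) (u v : Fin n → ℝ) : Integrable (fun P => GD P u v ^ k) μ := by
  obtain ⟨h1, h2, -⟩ := hμ
  refine Integrable.of_bound ((meas_GD u v).pow_const k).aestronglyMeasurable
    (((u ⬝ᵥ u) * (v ⬝ᵥ v)) ^ k) ?_
  filter_upwards [h2] with P hP
  rw [Real.norm_of_nonneg (pow_nonneg (GD_nonneg _ _ _) _)]
  exact pow_le_pow_left₀ (GD_nonneg _ _ _) (GD_le hP u v) k

lemma exists_Q {n : ℕ} (i j : Fin n) (hij : i ≠ j) (e f : Fin n → ℝ) (he : e ⬝ᵥ e = 1)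
    (hf : f ⬝ᵥ f = 1) (hef : e ⬝ᵥ f = 0) :
    ∃ Q ∈ Matrix.orthogonalGroup (Fin n) ℝ,
      Q *ᵥ (Pi.single i 1) = e ∧ Q *ᵥ (Pi.single j 1) = f := by
  classical
  let V : Fin n → EuclideanSpace ℝ (Fin n) := fun k => if k = i then WithLp.toLp 2 e else
    WithLp.toLp 2 f
  have hin : ∀ x y : Fin n → ℝ,
      inner ℝ (WithLp.toLp 2 x : EuclideanSpace ℝ (Fin n)) (WithLp.toLp 2 y) = x ⬝ᵥ y := by
    intro x y
    simp [PiLp.inner_apply, dotProduct, mul_comm]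
  have ho : Orthonormal ℝ (({i, j} : Set (Fin n)).domRestrict V) := by
    rw [orthonormal_iff_ite]
    rintro ⟨a, ha⟩ ⟨b, hb⟩
    simp only [Set.domRestrict_apply, Subtype.mk.injEq, V]
    rcases ha with rfl | rfl <;> rcases hb with rfl | rfl <;>
      simp [-inner_self_eq_norm_sq_to_K, -real_inner_self_eq_norm_sq, hin, he, hf, hef, hij,
        hij.symm, dotProduct_comm f e]
  obtain ⟨b, hb⟩ := ho.exists_orthonormalBasis_extension_of_card_eq (by simp)
  refine ⟨Matrix.of fun r c => b c r, ?_, ?_, ?_⟩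
  · rw [Matrix.mem_orthogonalGroup_iff']
    ext r c
    have := orthonormal_iff_ite.1 b.orthonormal r c
    simp only [PiLp.inner_apply] at this
    rw [Matrix.one_apply, ← this]
    simp [Matrix.mul_apply, Matrix.star_eq_conjTranspose, mul_comm]
  · ext r
    simp [hb i (by simp), V]
  · ext r
    simp [hb j (by simp), V, hij.symm]

lemma GD_int_eq {d n : ℕ} (μ : Measure (Matrix (Fin d) (Fin n) ℝ)) (hμ : IsHaarStiefel μ)
    (k : ℕ) (i j : Fin n) (hij : i ≠ j) (e f : Fin n → ℝ) (he : e ⬝ᵥ e = 1)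
    (hf : f ⬝ᵥ f = 1) (hef : e ⬝ᵥ f = 0) :
    ∫ P, GD P e f ^ k ∂μ = ∫ P, GD P (Pi.single i 1) (Pi.single j 1) ^ k ∂μ := by
  obtain ⟨Q, hQ, h1, h2⟩ := exists_Q i j hij e f he hf hef
  conv_rhs => rw [← hμ.2.2 Q hQ]
  rw [integral_map (meas_mul Q).aemeasurable
    ((meas_GD _ _).pow_const k).aestronglyMeasurable]
  simp only [GD, ← Matrix.mulVec_mulVec, h1, h2]

lemma GD_comb {d n : ℕ} (P : Matrix (Fin d) (Fin n) ℝ) (e f : Fin n → ℝ) (a b c : ℝ) :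
    GD P (a • e) (b • e + c • f) = (a * c) ^ 2 * GD P e f := by
  simp only [GD, dotR_eq, Matrix.mulVec_add, Matrix.mulVec_smul, dotProduct_add, add_dotProduct,
    smul_dotProduct, dotProduct_smul, smul_eq_mul, dotProduct_comm (P *ᵥ f) (P *ᵥ e)]
  ring

lemma unit_exists {n : ℕ} (x : Fin n → ℝ) (hx : x ≠ 0) :
    ∃ (a : ℝ) (e : Fin n → ℝ), a ≠ 0 ∧ x = a • e ∧ e = a⁻¹ • x ∧ e ⬝ᵥ e = 1 := by
  have h0 : x ⬝ᵥ x ≠ 0 := fun h => hx (dotProduct_self_eq_zero.1 h)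
  have h1 : 0 ≤ x ⬝ᵥ x := Finset.sum_nonneg fun i _ => mul_self_nonneg _
  have h2 : √(x ⬝ᵥ x) ≠ 0 := by
    rw [Real.sqrt_ne_zero h1]; exact h0
  refine ⟨√(x ⬝ᵥ x), (√(x ⬝ᵥ x))⁻¹ • x, h2, ?_, rfl, ?_⟩
  · rw [smul_smul, mul_inv_cancel₀ h2, one_smul]
  · simp only [smul_dotProduct, dotProduct_smul, smul_eq_mul]
    field_simp
    rw [Real.sq_sqrt h1]

lemma decomp {n : ℕ} (u v : Fin n → ℝ) :
    (∀ (d : ℕ) (P : Matrix (Fin d) (Fin n) ℝ), GD P u v = 0) ∨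
    ∃ (e f : Fin n → ℝ) (a b c : ℝ), e ⬝ᵥ e = 1 ∧ f ⬝ᵥ f = 1 ∧ e ⬝ᵥ f = 0 ∧
      u = a • e ∧ v = b • e + c • f := by
  by_cases hu : u = 0
  · left
    intro d P
    simp [GD, dotR_eq, hu]
  obtain ⟨a, e, ha, hue, -, he⟩ := unit_exists u hu
  by_cases hv : v - (e ⬝ᵥ v) • e = 0
  · left
    intro d P
    have : v = (e ⬝ᵥ v) • e + (0 : ℝ) • e := by
      rw [zero_smul, add_zero]; exact sub_eq_zero.1 hv
    rw [hue, this, GD_comb]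
    simp
  obtain ⟨c, f, hc, hvf, hfv, hf⟩ := unit_exists _ hv
  refine Or.inr ⟨e, f, a, e ⬝ᵥ v, c, he, hf, ?_, hue, ?_⟩
  · rw [hfv, dotProduct_smul, dotProduct_sub, dotProduct_smul, he]
    simp
  · rw [← hvf]; abel

lemma GD_moment {d n : ℕ} (μ : Measure (Matrix (Fin d) (Fin n) ℝ)) (hμ : IsHaarStiefel μ)
    (k : ℕ) (hk : k ≠ 0) (i j : Fin n) (hij : i ≠ j) (u v : Fin n → ℝ) :
    ∫ P, GD P u v ^ k ∂μ = (∫ P, GD P (Pi.single i 1) (Pi.single j 1) ^ k ∂μ) *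
      GD (1 : Matrix (Fin n) (Fin n) ℝ) u v ^ k := by
  rcases decomp u v with h | ⟨e, f, a, b, c, he, hf, hef, rfl, rfl⟩
  · simp [h, hk]
  · have h1 : GD (1 : Matrix (Fin n) (Fin n) ℝ) e f = 1 := by
      simp [GD, dotR_eq, he, hf, hef]
    simp only [GD_comb, mul_pow _ _ k, integral_const_mul, h1,
      GD_int_eq μ hμ k i j hij e f he hf hef]
    ring

lemma first_moment {d n : ℕ} (μ : Measure (Matrix (Fin d) (Fin n) ℝ)) (hμ : IsHaarStiefel μ)
    (i j : Fin n) (hij : i ≠ j) :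
    (∫ P, GD P (Pi.single i 1) (Pi.single j 1) ^ 1 ∂μ) * ((n : ℝ) * (n - 1)) =
      (d : ℝ) * (d - 1) := by
  have hp := hμ.1
  have A := fun v => LA_int μ (fun P u => GD P u v ^ 1) (fun u => GD_int μ hμ 1 u v)
  have B := (LA_int μ (fun P v => LA (fun u => GD P u v ^ 1)) fun v => (A v).1).2
  have C : ∫ P, LA (fun v => LA (fun u => GD P u v ^ 1)) ∂μ = (d : ℝ) * (d - 1) := by
    rw [integral_congr_ae (g := fun _ => (d : ℝ) * (d - 1))]
    · simp
    · filter_upwards [hμ.2.1] with P hP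
      simpa using LA_GD hP
  rw [← C, B]
  have E : ∀ v, ∫ P, LA (fun u => GD P u v ^ 1) ∂μ =
      (∫ P, GD P (Pi.single i 1) (Pi.single j 1) ^ 1 ∂μ) *
        LA (fun u => GD (1 : Matrix (Fin n) (Fin n) ℝ) u v ^ 1) := by
    intro v
    rw [(A v).2, ← LA_smul]
    congr 1
    funext u
    exact GD_moment μ hμ 1 one_ne_zero i j hij u v
  rw [funext E, LA_smul]
  congr 1
  simpa using (LA_GD (P := (1 : Matrix (Fin n) (Fin n) ℝ)) (by simp)).symm

lemma second_moment {d n : ℕ} (μ : Measure (Matrix (Fin d) (Fin n) ℝ)) (hμ : IsHaarStiefel μ)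
    (i j : Fin n) (hij : i ≠ j) :
    (∫ P, GD P (Pi.single i 1) (Pi.single j 1) ^ 2 ∂μ) *
      ((n : ℝ) * (n + 2) * ((n - 1) * (n + 1))) =
      (d : ℝ) * (d + 2) * ((d - 1) * (d + 1)) := by
  have hp := hμ.1
  have A := fun v => LB_int μ (fun P u => GD P u v ^ 2) (fun u => GD_int μ hμ 2 u v)
  have B := (LB_int μ (fun P v => LB (fun u => GD P u v ^ 2)) fun v => (A v).1).2
  have C : ∫ P, LB (fun v => LB (fun u => GD P u v ^ 2)) ∂μ =
      (d : ℝ) * (d + 2) * ((d - 1) * (d + 1)) := by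
    rw [integral_congr_ae (g := fun _ => (d : ℝ) * (d + 2) * ((d - 1) * (d + 1)))]
    · simp
    · filter_upwards [hμ.2.1] with P hP
      exact LB_GD hP
  rw [← C, B]
  have E : ∀ v, ∫ P, LB (fun u => GD P u v ^ 2) ∂μ =
      (∫ P, GD P (Pi.single i 1) (Pi.single j 1) ^ 2 ∂μ) *
        LB (fun u => GD (1 : Matrix (Fin n) (Fin n) ℝ) u v ^ 2) := by
    intro v
    rw [(A v).2, ← LB_smul]
    congr 1
    funext u
    exact GD_moment μ hμ 2 two_ne_zero i j hij u v
  rw [funext E, LB_smul]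
  congr 1
  exact (LB_GD (P := (1 : Matrix (Fin n) (Fin n) ℝ)) (by simp)).symm

/-- Moments of the projected Gram determinant
`D = ‖Pe₁‖²‖Pe₂‖² − ⟨Pe₁,Pe₂⟩²` for orthonormal `e₁, e₂` and Haar–Stiefel `P`
with `2 ≤ d ≤ n − 1`:
`E[D] = d(d−1)/(n(n−1))`,
`E[D²] = (d(d+2)/(n(n+2)))·((d−1)(d+1)/((n−1)(n+1)))`, and
`E[D²]/E[D]² = ((d+2)(d+1)/(d(d−1)))·(n(n−1)/((n+2)(n+1))) ≤ 6`. -/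
theorem gram_determinant_moments {n d : ℕ} (hd2 : 2 ≤ d) (hdn : d ≤ n - 1)
    (μ : Measure (Matrix (Fin d) (Fin n) ℝ)) (hμ : IsHaarStiefel μ)
    (e₁ e₂ : Fin n → ℝ) (he₁ : dotR e₁ e₁ = 1) (he₂ : dotR e₂ e₂ = 1) (he : dotR e₁ e₂ = 0) :
    (∫ P, (dotR (P.mulVec e₁) (P.mulVec e₁) * dotR (P.mulVec e₂) (P.mulVec e₂) -
          dotR (P.mulVec e₁) (P.mulVec e₂) ^ 2) ∂μ = (d : ℝ) * (d - 1) / (n * (n - 1))) ∧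
    (∫ P, (dotR (P.mulVec e₁) (P.mulVec e₁) * dotR (P.mulVec e₂) (P.mulVec e₂) -
          dotR (P.mulVec e₁) (P.mulVec e₂) ^ 2) ^ 2 ∂μ =
        ((d : ℝ) * (d + 2) / (n * (n + 2))) * (((d : ℝ) - 1) * (d + 1) / ((n - 1) * (n + 1)))) ∧
    ((∫ P, (dotR (P.mulVec e₁) (P.mulVec e₁) * dotR (P.mulVec e₂) (P.mulVec e₂) -
          dotR (P.mulVec e₁) (P.mulVec e₂) ^ 2) ^ 2 ∂μ) /
        (∫ P, (dotR (P.mulVec e₁) (P.mulVec e₁) * dotR (P.mulVec e₂) (P.mulVec e₂) -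
          dotR (P.mulVec e₁) (P.mulVec e₂) ^ 2) ∂μ) ^ 2 =
        (((d : ℝ) + 2) * ((d : ℝ) + 1) / ((d : ℝ) * ((d : ℝ) - 1))) *
          ((n : ℝ) * ((n : ℝ) - 1) / (((n : ℝ) + 2) * ((n : ℝ) + 1)))) ∧
    (((d : ℝ) + 2) * ((d : ℝ) + 1) / ((d : ℝ) * ((d : ℝ) - 1))) *
        ((n : ℝ) * ((n : ℝ) - 1) / (((n : ℝ) + 2) * ((n : ℝ) + 1))) ≤ 6 := by
  have hn : 3 ≤ n := by omega
  have hdR : (2 : ℝ) ≤ d := by exact_mod_cast hd2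
  have hnR : (3 : ℝ) ≤ n := by exact_mod_cast hn
  have hij : (⟨0, by omega⟩ : Fin n) ≠ ⟨1, by omega⟩ := by simp
  have m1 := first_moment μ hμ _ _ hij
  have m2 := second_moment μ hμ _ _ hij
  rw [← GD_int_eq μ hμ 1 _ _ hij e₁ e₂ he₁ he₂ he] at m1
  rw [← GD_int_eq μ hμ 2 _ _ hij e₁ e₂ he₁ he₂ he] at m2
  simp only [pow_one] at m1
  have a1 : (n : ℝ) - 1 ≠ 0 := by linarith
  have a2 : (n : ℝ) ≠ 0 := by linarith
  have a3 : (n : ℝ) + 1 ≠ 0 := by linarith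
  have a4 : (n : ℝ) + 2 ≠ 0 := by linarith
  have b1 : (d : ℝ) - 1 ≠ 0 := by linarith
  have b2 : (d : ℝ) ≠ 0 := by linarith
  have r1 : ∫ P, GD P e₁ e₂ ∂μ = (d : ℝ) * (d - 1) / (n * (n - 1)) := by
    rw [eq_div_iff (mul_ne_zero a2 a1)]; exact m1
  have r2 : ∫ P, GD P e₁ e₂ ^ 2 ∂μ =
      ((d : ℝ) * (d + 2) / (n * (n + 2))) * (((d : ℝ) - 1) * (d + 1) / ((n - 1) * (n + 1))) := by
    rw [div_mul_div_comm, eq_div_iff (by simp [a1, a2, a3, a4])]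
    linarith
  refine ⟨r1, r2, ?_, ?_⟩
  · change (∫ P, GD P e₁ e₂ ^ 2 ∂μ) / (∫ P, GD P e₁ e₂ ∂μ) ^ 2 = _
    rw [r1, r2]
    field_simp
  · have c1 : ((d : ℝ) + 2) * ((d : ℝ) + 1) / ((d : ℝ) * ((d : ℝ) - 1)) ≤ 6 := by
      rw [div_le_iff₀ (by nlinarith)]
      nlinarith
    have c2 : (n : ℝ) * ((n : ℝ) - 1) / (((n : ℝ) + 2) * ((n : ℝ) + 1)) ≤ 1 := by
      rw [div_le_one (by positivity)]
      nlinarith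
    have c3 : 0 ≤ (n : ℝ) * ((n : ℝ) - 1) / (((n : ℝ) + 2) * ((n : ℝ) + 1)) :=
      div_nonneg (by nlinarith) (by positivity)
    nlinarith
end

section
/- Set δ₀ := 1 − cos(1/10). There exist universal constants c_Γ > 0 and C_Γ > 0 such that for every ε with 0 < ε < min{1/8, δ₀/8}, every 1 ≤ d ≤ n, every Haar–Stiefel matrix P ∈ ℝ^{d×n}, and every pair of unit vectors u, v ∈ ℝⁿ with ⟨u,v⟩ < 1, one has P(Γ(P;u,v) ≥ d/(2n)) ≥ 1 − C_Γ·exp(−c_Γ ε² d). -/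
open MeasureTheory Matrix

open ProbabilityTheory

namespace GamAux

lemma integral_sq (t : ℝ) :
    ∫ x, Real.exp (t * x ^ 2) ∂(gaussianReal 0 1) = Real.sqrt (1 / (1 - 2 * t)) := by
  rw [integral_gaussianReal_eq_integral_smul one_ne_zero]
  have h : ∀ x : ℝ, gaussianPDFReal 0 1 x • Real.exp (t * x ^ 2)
      = (Real.sqrt (2 * Real.pi))⁻¹ * Real.exp (-(1 / 2 - t) * x ^ 2) := by
    intro x
    simp only [gaussianPDFReal, smul_eq_mul, mul_assoc, ← Real.exp_add]
    norm_num
    left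
    ring_nf
  simp_rw [h]
  rw [integral_const_mul, integral_gaussian, ← Real.sqrt_inv, ← Real.sqrt_mul (by positivity)]
  congr 1
  have hp := Real.pi_ne_zero
  by_cases h1 : 1 - 2 * t = 0
  · have : 1 / 2 - t = 0 := by linarith
    rw [h1, this]; simp
  · have : 1 / 2 - t ≠ 0 := fun h => h1 (by linarith)
    field_simp

lemma integrable_sq (t : ℝ) (ht : t < 1 / 2) :
    Integrable (fun x : ℝ => Real.exp (t * x ^ 2)) (gaussianReal 0 1) := by
  apply Integrable.of_integral_ne_zero
  rw [integral_sq]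
  have : 0 < 1 - 2 * t := by linarith
  positivity

/-- product Gaussian -/
noncomputable def gam (n : ℕ) : Measure (Fin n → ℝ) := Measure.pi (fun _ => gaussianReal 0 1)

instance (n : ℕ) : IsProbabilityMeasure (gam n) := by unfold gam; infer_instance

lemma exp_dot {n : ℕ} (t : ℝ) (x : Fin n → ℝ) :
    Real.exp (t * dotR x x) = ∏ i, Real.exp (t * x i ^ 2) := by
  rw [← Real.exp_sum, dotR, Finset.mul_sum]
  simp only [pow_two]

lemma integrable_dot (n : ℕ) (t : ℝ) (ht : t < 1 / 2) :
    Integrable (fun x : Fin n → ℝ => Real.exp (t * dotR x x)) (gam n) := by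
  simp_rw [exp_dot]
  exact Integrable.fintype_prod (f := fun _ x => Real.exp (t * x ^ 2)) fun _ => integrable_sq t ht

lemma mgf_dot (n : ℕ) (t : ℝ) :
    mgf (fun x : Fin n → ℝ => dotR x x) (gam n) t = Real.sqrt (1 / (1 - 2 * t)) ^ n := by
  unfold mgf
  simp_rw [exp_dot]
  unfold gam
  rw [integral_fintype_prod_eq_pow (fun x : ℝ => Real.exp (t * x ^ 2)), integral_sq]
  simp

lemma upper_tail (n : ℕ) :
    (gam n) {x | (11 / 10 : ℝ) * n ≤ dotR x x} ≤ ENNReal.ofReal (Real.exp (-(1 / 1000) * n)) := by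
  have h := measure_ge_le_exp_mul_mgf (μ := gam n) (X := fun x : Fin n → ℝ => dotR x x)
    (t := 1 / 22) ((11 / 10 : ℝ) * n) (by norm_num) (integrable_dot n _ (by norm_num))
  rw [mgf_dot] at h
  rw [← ofReal_measureReal]
  apply ENNReal.ofReal_le_ofReal
  refine h.trans ?_
  have h1 : Real.sqrt (1 / (1 - 2 * (1 / 22))) ≤ Real.exp (49 / 1000) := by
    rw [Real.sqrt_le_left (by positivity), ← Real.exp_nat_mul]
    have := Real.quadratic_le_exp_of_nonneg (x := (2 : ℕ) * (49 / 1000)) (by norm_num)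
    refine le_trans ?_ this
    norm_num
  calc _ ≤ Real.exp (-(1 / 22) * (11 / 10 * n)) * Real.exp (49 / 1000) ^ n := by gcongr
    _ = _ := by
      rw [← Real.exp_nat_mul, ← Real.exp_add]
      congr 1
      ring

lemma lower_tail (n : ℕ) :
    (gam n) {x | dotR x x ≤ (9 / 10 : ℝ) * n} ≤ ENNReal.ofReal (Real.exp (-(1 / 1000) * n)) := by
  have h := measure_le_le_exp_mul_mgf (μ := gam n) (X := fun x : Fin n → ℝ => dotR x x)
    (t := -1 / 18) ((9 / 10 : ℝ) * n) (by norm_num) (integrable_dot n _ (by norm_num))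
  rw [mgf_dot] at h
  rw [← ofReal_measureReal]
  apply ENNReal.ofReal_le_ofReal
  refine h.trans ?_
  have h1 : Real.sqrt (1 / (1 - 2 * (-1 / 18))) ≤ Real.exp (-51 / 1000) := by
    rw [Real.sqrt_le_left (by positivity)]
    have := Real.add_one_le_exp (-51 / 1000 : ℝ)
    nlinarith
  calc _ ≤ Real.exp (-(-1 / 18) * (9 / 10 * n)) * Real.exp (-51 / 1000) ^ n := by gcongr
    _ = _ := by
      rw [← Real.exp_nat_mul, ← Real.exp_add]
      congr 1
      ring

lemma gam_map {d n : ℕ} (P : Matrix (Fin d) (Fin n) ℝ) (hP : P * Pᵀ = 1) :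
    (gam n).map (fun x => P *ᵥ x) = gam d := by
  have hm : Measurable (fun x : Fin n → ℝ => P *ᵥ x) := by
    apply Continuous.measurable; fun_prop
  have key : ((gam n).map (fun x => P *ᵥ x)).map (WithLp.toLp 2) = (gam d).map (WithLp.toLp 2) := by
    have hpm : IsProbabilityMeasure ((gam n).map (fun x => P *ᵥ x)) :=
      Measure.isProbabilityMeasure_map hm.aemeasurable
    have e1 : IsProbabilityMeasure
      (((gam n).map (fun x => P *ᵥ x)).map (WithLp.toLp 2) : Measure (EuclideanSpace ℝ (Fin d))) :=
      Measure.isProbabilityMeasure_map (by fun_prop)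
    have e2 : IsProbabilityMeasure
      ((gam d).map (WithLp.toLp 2) : Measure (EuclideanSpace ℝ (Fin d))) :=
      Measure.isProbabilityMeasure_map (by fun_prop)
    apply Measure.ext_of_charFun (E := EuclideanSpace ℝ (Fin d))
    ext t
    have hn : charFun ((gam n).map (WithLp.toLp 2)) (WithLp.toLp 2 (Pᵀ *ᵥ t.ofLp))
        = charFun (((gam n).map (fun x => P *ᵥ x)).map (WithLp.toLp 2)) t := by
      rw [charFun_apply, charFun_apply, Measure.map_map (by fun_prop) hm,
        integral_map (by fun_prop) (by fun_prop),
        integral_map (Measurable.aemeasurable (by fun_prop)) (by fun_prop)]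
      congr 1
      ext x
      congr 3
      simp only [Function.comp, PiLp.inner_apply]
      simp only [RCLike.inner_apply, conj_trivial, Matrix.mulVec_transpose]
      exact (Matrix.dotProduct_mulVec _ _ _).symm
    rw [← hn]
    unfold gam
    rw [map_pi_eq_stdGaussian, map_pi_eq_stdGaussian, charFun_stdGaussian, charFun_stdGaussian]
    congr 4
    rw [EuclideanSpace.norm_eq, EuclideanSpace.norm_eq]
    congr 1
    congr 1
    simp only [Real.norm_eq_abs, sq_abs]
    simp only [pow_two]
    change (Pᵀ *ᵥ t.ofLp) ⬝ᵥ (Pᵀ *ᵥ t.ofLp) = t.ofLp ⬝ᵥ t.ofLp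
    rw [Matrix.dotProduct_mulVec, Matrix.vecMul_transpose, Matrix.mulVec_mulVec, hP,
      Matrix.one_mulVec]
  have h := congrArg (Measure.map (WithLp.ofLp)) key
  have e : (WithLp.ofLp ∘ WithLp.toLp 2 : (Fin d → ℝ) → (Fin d → ℝ)) = id := rfl
  have e' : ∀ ν : Measure (Fin d → ℝ), (ν.map (WithLp.toLp 2)).map WithLp.ofLp = ν := by
    intro ν
    rw [Measure.map_map (by fun_prop) (by fun_prop), e, Measure.map_id]
  rwa [e', e'] at h

lemma exists_orth {n : ℕ} (w w' : Fin n → ℝ) (h : dotR w w = dotR w' w') :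
    ∃ Q ∈ Matrix.orthogonalGroup (Fin n) ℝ, Q *ᵥ w = w' := by
  change w ⬝ᵥ w = w' ⬝ᵥ w' at h
  by_cases hw : w = w'
  · exact ⟨1, one_mem _, by simp [hw]⟩
  set k := w - w' with hk
  have hk0 : k ⬝ᵥ k ≠ 0 := by
    rw [Ne, dotProduct_self_eq_zero]
    exact sub_ne_zero.mpr hw
  have hkw : 2 * (k ⬝ᵥ w) = k ⬝ᵥ k := by
    simp only [hk, sub_dotProduct, dotProduct_sub, dotProduct_comm w' w, h]
    ring
  refine ⟨1 - (2 / (k ⬝ᵥ k)) • vecMulVec k k, ?_, ?_⟩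
  · rw [Matrix.mem_orthogonalGroup_iff]
    simp only [transpose_sub, transpose_one, transpose_smul, transpose_vecMulVec]
    rw [sub_mul, mul_sub, mul_sub, smul_mul_smul_comm, vecMulVec_mul_vecMulVec]
    simp only [one_mul, mul_one, vecMulVec_smul, smul_smul]
    rw [sub_sub, sub_eq_self, ← sub_smul, ← add_smul]
    convert zero_smul ℝ _ using 2
    field_simp
    ring
  · rw [sub_mulVec, smul_mulVec, vecMulVec_mulVec, one_mulVec]
    have : (2 / (k ⬝ᵥ k)) • (MulOpposite.op (k ⬝ᵥ w) • k) = k := by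
      rw [op_smul_eq_smul, smul_smul]
      convert one_smul ℝ k using 2
      field_simp
      exact hkw
    rw [this, hk]
    simp

/-- the deviation set -/
def Bad (d n : ℕ) : Set (Matrix (Fin d) (Fin n) ℝ × (Fin n → ℝ)) :=
  {p | ¬ (3 / 4 * ((d : ℝ) / n) * dotR p.2 p.2 < dotR (p.1 *ᵥ p.2) (p.1 *ᵥ p.2) ∧
      dotR (p.1 *ᵥ p.2) (p.1 *ᵥ p.2) < 5 / 4 * ((d : ℝ) / n) * dotR p.2 p.2)}

lemma meas_entry {d n : ℕ} (i : Fin d) (j : Fin n) :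
    Measurable (fun P : Matrix (Fin d) (Fin n) ℝ => P i j) :=
  (measurable_pi_apply j).comp (measurable_pi_apply (X := fun _ : Fin d => Fin n → ℝ) i)

lemma bad_meas (d n : ℕ) : MeasurableSet (Bad d n) := by
  have h1 : Measurable (fun p : Matrix (Fin d) (Fin n) ℝ × (Fin n → ℝ) => dotR p.2 p.2) := by
    unfold dotR; fun_prop
  have h3 : ∀ i, Measurable
      (fun p : Matrix (Fin d) (Fin n) ℝ × (Fin n → ℝ) => (p.1 *ᵥ p.2) i) := by
    intro i
    have h4 : ∀ j, Measurable
        (fun p : Matrix (Fin d) (Fin n) ℝ × (Fin n → ℝ) => p.1 i j * p.2 j) := fun j =>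
      ((meas_entry i j).comp measurable_fst).mul ((measurable_pi_apply j).comp measurable_snd)
    simp only [Matrix.mulVec, dotProduct]
    exact Finset.measurable_sum _ fun j _ => h4 j
  have h2 : Measurable (fun p : Matrix (Fin d) (Fin n) ℝ × (Fin n → ℝ) =>
      dotR (p.1 *ᵥ p.2) (p.1 *ᵥ p.2)) :=
    Finset.measurable_sum _ fun j _ => (h3 j).mul (h3 j)
  exact ((measurableSet_lt (h1.const_mul _) h2).inter
    (measurableSet_lt h2 (h1.const_mul _))).compl

lemma dotR_smul {m : ℕ} (s : ℝ) (x : Fin m → ℝ) : dotR (s • x) (s • x) = s ^ 2 * dotR x x := by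
  simp only [dotR, Finset.mul_sum, Pi.smul_apply, smul_eq_mul]
  exact Finset.sum_congr rfl fun i _ => by ring

lemma bad_le {d n : ℕ} (μ : Measure (Matrix (Fin d) (Fin n) ℝ)) (hμ : IsHaarStiefel μ)
    (w : Fin n → ℝ) (hw : dotR w w = 1) (g : Fin n → ℝ) :
    μ ((fun P => (P, w)) ⁻¹' Bad d n) ≤ μ ((fun P => (P, g)) ⁻¹' Bad d n) := by
  obtain ⟨-, -, hinv⟩ := hμ
  have hg : 0 ≤ dotR g g := Finset.sum_nonneg fun i _ => mul_self_nonneg _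
  set s := Real.sqrt (dotR g g) with hs
  have hs2 : s ^ 2 = dotR g g := Real.sq_sqrt hg
  obtain ⟨Q, hQ, hQw⟩ := exists_orth (s • w) g (by rw [dotR_smul, hw, hs2, mul_one])
  have hmQ : Measurable (fun P : Matrix (Fin d) (Fin n) ℝ => P * Q) := by
    refine measurable_pi_lambda _ fun i => measurable_pi_lambda _ fun j => ?_
    simp only [Matrix.mul_apply]
    exact Finset.measurable_sum _ fun k _ => (meas_entry i k).mul_const (Q k j)
  have hms : MeasurableSet ((fun P : Matrix (Fin d) (Fin n) ℝ => (P, s • w)) ⁻¹' Bad d n) :=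
    measurable_prodMk_right (bad_meas d n)
  have e : μ ((fun P => (P, g)) ⁻¹' Bad d n) = μ ((fun P => (P, s • w)) ⁻¹' Bad d n) := by
    conv_rhs => rw [← hinv Q hQ, Measure.map_apply hmQ hms]
    congr 1
    ext P
    simp only [Bad, Set.mem_preimage, Set.mem_ofPred_eq, ← Matrix.mulVec_mulVec, hQw, dotR_smul, hw,
      hs2, mul_one]
  rw [e]
  apply measure_mono
  intro P hP
  simp only [Bad, Set.mem_preimage, Set.mem_ofPred_eq, Matrix.mulVec_smul, dotR_smul, hw,
      mul_one] at hP ⊢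
  intro h
  apply hP
  have hs0 : 0 < s ^ 2 := by
    rcases (sq_nonneg s).eq_or_lt with h0 | h0
    · rw [← h0] at h; simp at h
    · exact h0
  constructor
  · nlinarith [h.1]
  · nlinarith [h.2]

lemma conc {d n : ℕ} (hd : 1 ≤ d) (hdn : d ≤ n) (μ : Measure (Matrix (Fin d) (Fin n) ℝ))
    (hμ : IsHaarStiefel μ) (w : Fin n → ℝ) (hw : dotR w w = 1) :
    μ ((fun P => (P, w)) ⁻¹' Bad d n) ≤ 4 * ENNReal.ofReal (Real.exp (-(1 / 1000) * d)) := by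
  have hprob := hμ.1
  have hfib : ∀ᵐ P ∂μ, gam n (Prod.mk P ⁻¹' Bad d n)
      ≤ 4 * ENNReal.ofReal (Real.exp (-(1 / 1000) * d)) := by
    filter_upwards [hμ.2.1] with P hP
    have hm : Measurable (fun x : Fin n → ℝ => P *ᵥ x) := by
      apply Continuous.measurable; fun_prop
    have hdm : Measurable (fun x : Fin d → ℝ => dotR x x) := by unfold dotR; fun_prop
    have t1 := upper_tail d
    have t2 := lower_tail d
    rw [← gam_map P hP, Measure.map_apply hm (measurableSet_le (by fun_prop) hdm)] at t1
    rw [← gam_map P hP, Measure.map_apply hm (measurableSet_le hdm (by fun_prop))] at t2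
    have hnd : ENNReal.ofReal (Real.exp (-(1 / 1000) * n))
        ≤ ENNReal.ofReal (Real.exp (-(1 / 1000) * d)) := by
      apply ENNReal.ofReal_le_ofReal
      apply Real.exp_le_exp.mpr
      have : (d : ℝ) ≤ n := by exact_mod_cast hdn
      linarith
    have t3 := (upper_tail n).trans hnd
    have t4 := (lower_tail n).trans hnd
    have hsub : Prod.mk P ⁻¹' Bad d n ⊆
        ((((fun x => P *ᵥ x) ⁻¹' {x | (11 / 10 : ℝ) * d ≤ dotR x x}) ∪
          ((fun x => P *ᵥ x) ⁻¹' {x | dotR x x ≤ (9 / 10 : ℝ) * d})) ∪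
          {x | (11 / 10 : ℝ) * n ≤ dotR x x}) ∪ {x | dotR x x ≤ (9 / 10 : ℝ) * n} := by
      intro g hg
      by_contra hc
      simp only [Set.mem_union, Set.mem_preimage, Set.mem_ofPred_eq, not_or, not_le] at hc
      obtain ⟨⟨⟨h1, h2⟩, h3⟩, h4⟩ := hc
      apply hg
      have hd0 : (0 : ℝ) < d := by exact_mod_cast hd
      have hn0 : (0 : ℝ) < n := by exact_mod_cast (lt_of_lt_of_le hd hdn)
      have hm0 : (0 : ℝ) < (d : ℝ) / n := by positivity
      have hmn : (d : ℝ) / n * n = d := by field_simp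
      constructor
      · change 3 / 4 * ((d : ℝ) / n) * dotR g g < dotR (P *ᵥ g) (P *ᵥ g)
        nlinarith [mul_lt_mul_of_pos_left h3 hm0]
      · change dotR (P *ᵥ g) (P *ᵥ g) < 5 / 4 * ((d : ℝ) / n) * dotR g g
        nlinarith [mul_lt_mul_of_pos_left h4 hm0]
    refine (measure_mono hsub).trans ?_
    refine (measure_union_le _ _).trans ?_
    refine (add_le_add ((measure_union_le _ _).trans
      (add_le_add (measure_union_le _ _) le_rfl)) le_rfl).trans ?_
    refine (add_le_add (add_le_add (add_le_add t1 t2) t3) t4).trans (le_of_eq ?_)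
    ring
  calc μ ((fun P => (P, w)) ⁻¹' Bad d n)
      = ∫⁻ _, μ ((fun P => (P, w)) ⁻¹' Bad d n) ∂(gam n) := by simp
    _ ≤ ∫⁻ g, μ ((fun P => (P, g)) ⁻¹' Bad d n) ∂(gam n) :=
        lintegral_mono fun g => bad_le μ hμ w hw g
    _ = (μ.prod (gam n)) (Bad d n) := (Measure.prod_apply_symm (bad_meas d n)).symm
    _ = ∫⁻ P, gam n (Prod.mk P ⁻¹' Bad d n) ∂μ := Measure.prod_apply (bad_meas d n)
    _ ≤ ∫⁻ _, 4 * ENNReal.ofReal (Real.exp (-(1 / 1000) * d)) ∂μ := lintegral_mono_ae hfib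
    _ = _ := by simp

lemma scalar (m K S A B C X Y Z : ℝ) (hm : 0 ≤ m) (hS : 0 < S) (hX : X = K * A)
    (hY : Y = S * B) (hZ : Z ^ 2 = K * S * C ^ 2) (hB : m / 2 ≤ B)
    (hC : 0 ≤ K * (A * (B - m / 2) - C ^ 2)) (h1 : 0 ≤ X + Y + 2 * Z) :
    m / 2 ≤ (Real.sqrt (X + Y + 2 * Z) * Real.sqrt (X + Y - 2 * Z) - (X - Y)) / (2 * S) := by
  rw [le_div_iff₀ (by positivity), ← Real.sqrt_mul h1]
  have : m * S + X - Y ≤ Real.sqrt ((X + Y + 2 * Z) * (X + Y - 2 * Z)) := by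
    apply Real.le_sqrt_of_sq_le
    have e : (X + Y + 2 * Z) * (X + Y - 2 * Z) - (m * S + X - Y) ^ 2
        = S * (4 * (K * (A * (B - m / 2) - C ^ 2)) + S * (2 * m * (B - m / 2))) := by
      have : (X + Y + 2 * Z) * (X + Y - 2 * Z) = (X + Y) ^ 2 - 4 * Z ^ 2 := by ring
      rw [this, hZ, hX, hY]
      ring
    have hB' : 0 ≤ B - m / 2 := by linarith
    have : 0 ≤ S * (4 * (K * (A * (B - m / 2) - C ^ 2)) + S * (2 * m * (B - m / 2))) := by
      positivity
    linarith
  linarith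

lemma gam_eq {d n : ℕ} (P : Matrix (Fin d) (Fin n) ℝ) (u v p q : Fin n → ℝ) (hu : u = p + q)
    (hv : v = p - q) (hu1 : dotR u u = 1) (hv1 : dotR v v = 1) :
    p ⬝ᵥ q = 0 ∧ 1 - dotR u v = 2 * (q ⬝ᵥ q) ∧
    0 ≤ (P *ᵥ p) ⬝ᵥ (P *ᵥ p) + (P *ᵥ q) ⬝ᵥ (P *ᵥ q) + 2 * ((P *ᵥ p) ⬝ᵥ (P *ᵥ q)) ∧
    Gam P u v = (Real.sqrt ((P *ᵥ p) ⬝ᵥ (P *ᵥ p) + (P *ᵥ q) ⬝ᵥ (P *ᵥ q)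
        + 2 * ((P *ᵥ p) ⬝ᵥ (P *ᵥ q))) *
      Real.sqrt ((P *ᵥ p) ⬝ᵥ (P *ᵥ p) + (P *ᵥ q) ⬝ᵥ (P *ᵥ q) - 2 * ((P *ᵥ p) ⬝ᵥ (P *ᵥ q)))
      - ((P *ᵥ p) ⬝ᵥ (P *ᵥ p) - (P *ᵥ q) ⬝ᵥ (P *ᵥ q))) / (2 * (q ⬝ᵥ q)) := by
  have dr : ∀ (k : ℕ) (x y : Fin k → ℝ), dotR x y = x ⬝ᵥ y := fun _ _ _ => rfl
  subst hu hv
  have e1 : dotR (P *ᵥ (p + q)) (P *ᵥ (p + q)) = (P *ᵥ p) ⬝ᵥ (P *ᵥ p) + (P *ᵥ q) ⬝ᵥ (P *ᵥ q)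
        + 2 * ((P *ᵥ p) ⬝ᵥ (P *ᵥ q)) := by
    rw [dr, mulVec_add, add_dotProduct, dotProduct_add, dotProduct_add,
      dotProduct_comm (P *ᵥ q) (P *ᵥ p)]
    ring
  have e2 : dotR (P *ᵥ (p - q)) (P *ᵥ (p - q)) = (P *ᵥ p) ⬝ᵥ (P *ᵥ p) + (P *ᵥ q) ⬝ᵥ (P *ᵥ q)
        - 2 * ((P *ᵥ p) ⬝ᵥ (P *ᵥ q)) := by
    rw [dr, mulVec_sub, sub_dotProduct, dotProduct_sub, dotProduct_sub,
      dotProduct_comm (P *ᵥ q) (P *ᵥ p)]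
    ring
  have e3 : dotR (P *ᵥ (p + q)) (P *ᵥ (p - q))
      = (P *ᵥ p) ⬝ᵥ (P *ᵥ p) - (P *ᵥ q) ⬝ᵥ (P *ᵥ q) := by
    rw [dr, mulVec_sub, mulVec_add, add_dotProduct, dotProduct_sub, dotProduct_sub,
      dotProduct_comm (P *ᵥ q) (P *ᵥ p)]
    ring
  rw [dr, add_dotProduct, dotProduct_add, dotProduct_add, dotProduct_comm q p] at hu1
  rw [dr, sub_dotProduct, dotProduct_sub, dotProduct_sub, dotProduct_comm q p] at hv1
  have e4 : 1 - dotR (p + q) (p - q) = 2 * (q ⬝ᵥ q) := by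
    rw [dr, add_dotProduct, dotProduct_sub, dotProduct_sub, dotProduct_comm q p]
    linarith
  refine ⟨by linarith, e4, ?_, ?_⟩
  · rw [← e1]
    exact Finset.sum_nonneg fun i _ => mul_self_nonneg _
  · rw [Gam, norR, norR, e1, e2, e3, e4]

lemma good {d n : ℕ} (P : Matrix (Fin d) (Fin n) ℝ) (w : Fin n → ℝ) (hw : dotR w w = 1)
    (h : (P, w) ∉ Bad d n) : 3 / 4 * ((d : ℝ) / n) < (P *ᵥ w) ⬝ᵥ (P *ᵥ w) ∧
      (P *ᵥ w) ⬝ᵥ (P *ᵥ w) < 5 / 4 * ((d : ℝ) / n) := by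
  have := not_not.mp h
  simp only [hw, mul_one] at this
  exact this

lemma four {d n : ℕ} (u v : Fin n → ℝ) (hu1 : dotR u u = 1) (hv1 : dotR v v = 1)
    (huv : dotR u v < 1) : ∃ w1 w2 w3 w4 : Fin n → ℝ, dotR w1 w1 = 1 ∧ dotR w2 w2 = 1 ∧
      dotR w3 w3 = 1 ∧ dotR w4 w4 = 1 ∧ ∀ P : Matrix (Fin d) (Fin n) ℝ,
      (P, w1) ∉ Bad d n → (P, w2) ∉ Bad d n → (P, w3) ∉ Bad d n → (P, w4) ∉ Bad d n →
      (d : ℝ) / (2 * n) ≤ Gam P u v := by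
  obtain ⟨p, hp⟩ : ∃ p : Fin n → ℝ, p = (1 / 2 : ℝ) • (u + v) := ⟨_, rfl⟩
  obtain ⟨q, hq⟩ : ∃ q : Fin n → ℝ, q = (1 / 2 : ℝ) • (u - v) := ⟨_, rfl⟩
  have hu : u = p + q := by
    ext i; simp only [hp, hq, Pi.add_apply, Pi.sub_apply, Pi.smul_apply, smul_eq_mul]; ring
  have hv : v = p - q := by
    ext i; simp only [hp, hq, Pi.add_apply, Pi.sub_apply, Pi.smul_apply, smul_eq_mul]; ring
  have hG := fun P : Matrix (Fin d) (Fin n) ℝ => gam_eq P u v p q hu hv hu1 hv1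
  obtain ⟨hpq, hS, -⟩ := hG 0
  have hm : (0 : ℝ) ≤ (d : ℝ) / n := by positivity
  have hme : (d : ℝ) / (2 * n) = (d : ℝ) / n / 2 := by rw [div_div, mul_comm]
  have hS0 : 0 < q ⬝ᵥ q := by linarith
  have hsq := Real.mul_self_sqrt hS0.le
  have hs0 : 0 < Real.sqrt (q ⬝ᵥ q) := Real.sqrt_pos.mpr hS0
  generalize Real.sqrt (q ⬝ᵥ q) = s at hsq hs0
  obtain ⟨b, hb⟩ : ∃ b : Fin n → ℝ, q = s • b := ⟨s⁻¹ • q, by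
    rw [smul_smul, mul_inv_cancel₀ hs0.ne', one_smul]⟩
  have hb1 : b ⬝ᵥ b = 1 := by
    rw [hb, smul_dotProduct, dotProduct_smul, smul_eq_mul, smul_eq_mul, ← mul_assoc] at hsq
    have : s * s ≠ 0 := by positivity
    exact mul_left_cancel₀ this (by linarith)
  have hY : ∀ P : Matrix (Fin d) (Fin n) ℝ,
      (P *ᵥ q) ⬝ᵥ (P *ᵥ q) = (q ⬝ᵥ q) * ((P *ᵥ b) ⬝ᵥ (P *ᵥ b)) := by
    intro P
    rw [← hsq, hb, mulVec_smul, smul_dotProduct, dotProduct_smul, smul_eq_mul, smul_eq_mul,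
      ← mul_assoc]
  by_cases hp0 : p = 0
  · refine ⟨b, b, b, b, hb1, hb1, hb1, hb1, fun P hP _ _ _ => ?_⟩
    obtain ⟨-, -, h1, h2⟩ := hG P
    rw [hme, h2]
    have := good P b hb1 hP
    refine scalar _ 0 _ 0 _ 0 _ _ _ hm hS0 (by simp [hp0]) (hY P) (by simp [hp0])
      (by linarith) (by simp) h1
  have hK0 : 0 < p ⬝ᵥ p := by
    refine lt_of_le_of_ne (Finset.sum_nonneg fun i _ => mul_self_nonneg _) (Ne.symm ?_)
    rwa [Ne, dotProduct_self_eq_zero]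
  have hkq := Real.mul_self_sqrt hK0.le
  have hk0 : 0 < Real.sqrt (p ⬝ᵥ p) := Real.sqrt_pos.mpr hK0
  generalize Real.sqrt (p ⬝ᵥ p) = k at hkq hk0
  obtain ⟨a, ha⟩ : ∃ a : Fin n → ℝ, p = k • a := ⟨k⁻¹ • p, by
    rw [smul_smul, mul_inv_cancel₀ hk0.ne', one_smul]⟩
  have ha1 : a ⬝ᵥ a = 1 := by
    rw [ha, smul_dotProduct, dotProduct_smul, smul_eq_mul, smul_eq_mul, ← mul_assoc] at hkq
    have : k * k ≠ 0 := by positivity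
    exact mul_left_cancel₀ this (by linarith)
  have hab : a ⬝ᵥ b = 0 := by
    rw [ha, hb, smul_dotProduct, dotProduct_smul, smul_eq_mul, smul_eq_mul] at hpq
    exact ((mul_eq_zero.mp ((mul_eq_zero.mp hpq).resolve_left hk0.ne')).resolve_left hs0.ne')
  obtain ⟨r, hr⟩ : ∃ r : ℝ, r * r = 1 / 2 := ⟨Real.sqrt (1 / 2), Real.mul_self_sqrt (by norm_num)⟩
  have hE : ∀ (k : ℕ) (x y : Fin k → ℝ), (r • (x + y)) ⬝ᵥ (r • (x + y))
      = 1 / 2 * (x ⬝ᵥ x + y ⬝ᵥ y + 2 * (x ⬝ᵥ y)) := by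
    intro k x y
    rw [← hr, smul_dotProduct, dotProduct_smul, add_dotProduct, dotProduct_add, dotProduct_add,
      dotProduct_comm y x, smul_eq_mul, smul_eq_mul]
    ring
  have hF : ∀ (k : ℕ) (x y : Fin k → ℝ), (r • (x - y)) ⬝ᵥ (r • (x - y))
      = 1 / 2 * (x ⬝ᵥ x + y ⬝ᵥ y - 2 * (x ⬝ᵥ y)) := by
    intro k x y
    rw [← hr, smul_dotProduct, dotProduct_smul, sub_dotProduct, dotProduct_sub, dotProduct_sub,
      dotProduct_comm y x, smul_eq_mul, smul_eq_mul]
    ring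
  have hE1 : dotR (r • (a + b)) (r • (a + b)) = 1 := by
    refine (hE n a b).trans ?_
    rw [ha1, hb1, hab]; norm_num
  have hF1 : dotR (r • (a - b)) (r • (a - b)) = 1 := by
    refine (hF n a b).trans ?_
    rw [ha1, hb1, hab]; norm_num
  refine ⟨a, b, r • (a + b), r • (a - b), ha1, hb1, hE1, hF1, fun P h1 h2 h3 h4 => ?_⟩
  obtain ⟨g1, -⟩ := good P _ ha1 h1
  obtain ⟨g2, -⟩ := good P _ hb1 h2
  obtain ⟨g3, g3'⟩ := good P _ hE1 h3
  obtain ⟨g4, g4'⟩ := good P _ hF1 h4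
  rw [mulVec_smul, mulVec_add, hE] at g3 g3'
  rw [mulVec_smul, mulVec_sub, hF] at g4 g4'
  obtain ⟨-, -, hpos, hGam⟩ := hG P
  rw [hme, hGam]
  refine scalar _ (p ⬝ᵥ p) _ ((P *ᵥ a) ⬝ᵥ (P *ᵥ a)) _ ((P *ᵥ a) ⬝ᵥ (P *ᵥ b)) _ _ _ hm hS0 ?_
    (hY P) ?_ (by linarith) ?_ hpos
  · rw [← hkq, ha, mulVec_smul, smul_dotProduct, dotProduct_smul, smul_eq_mul, smul_eq_mul,
      ← mul_assoc]
  · rw [← hkq, ← hsq, ha, hb, mulVec_smul, mulVec_smul, smul_dotProduct, dotProduct_smul,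
      smul_eq_mul, smul_eq_mul]
    ring
  · apply mul_nonneg hK0.le
    generalize (P *ᵥ a) ⬝ᵥ (P *ᵥ a) = A at *
    generalize (P *ᵥ b) ⬝ᵥ (P *ᵥ b) = B at *
    generalize (P *ᵥ a) ⬝ᵥ (P *ᵥ b) = C at *
    generalize (d : ℝ) / n = m at *
    have c1 : C < m / 4 := by linarith
    have c2 : -(m / 4) < C := by linarith
    have c3 : C ^ 2 ≤ (m / 4) ^ 2 := sq_le_sq' c2.le c1.le
    have c4 : (3 / 4 * m) * (m / 4) ≤ A * (B - m / 2) :=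
      mul_le_mul g1.le (by linarith) (by linarith) (by linarith)
    nlinarith

end GamAux

/-- Uniform high-probability lower bound for `Γ(P;u,v)`: with `δ₀ = 1 − cos(1/10)`,
there are universal constants `c_Γ, C_Γ > 0` such that for every
`0 < ε < min{1/8, δ₀/8}`, every `1 ≤ d ≤ n`, every Haar–Stiefel `P ∈ ℝ^{d×n}`, and
all unit vectors `u, v` with `⟨u,v⟩ < 1`,
`P(Γ(P;u,v) ≥ d/(2n)) ≥ 1 − C_Γ exp(−c_Γ ε² d)`. -/
theorem Gamma_high_probability_lower_bound :
    ∃ cΓ : ℝ, 0 < cΓ ∧ ∃ CΓ : ℝ, 0 < CΓ ∧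
      ∀ ε : ℝ, 0 < ε → ε < min (1 / 8) ((1 - Real.cos (1 / 10)) / 8) →
      ∀ n d : ℕ, 1 ≤ d → d ≤ n →
      ∀ μ : Measure (Matrix (Fin d) (Fin n) ℝ), IsHaarStiefel μ →
      ∀ u v : Fin n → ℝ, dotR u u = 1 → dotR v v = 1 → dotR u v < 1 →
        ENNReal.ofReal (1 - CΓ * Real.exp (-(cΓ * ε ^ 2 * d))) ≤
          μ {P | (d : ℝ) / (2 * n) ≤ Gam P u v} := by
  refine ⟨1 / 1000, by norm_num, 16, by norm_num, ?_⟩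
  intro ε hε hε2 n d hd hdn μ hμ u v hu hv huv
  have hprob := hμ.1
  obtain ⟨w1, w2, w3, w4, h1, h2, h3, h4, H⟩ := GamAux.four (d := d) u v hu hv huv
  set e := ENNReal.ofReal (Real.exp (-(1 / 1000) * d)) with he
  have hcover : (Set.univ : Set (Matrix (Fin d) (Fin n) ℝ)) ⊆
      {P | (d : ℝ) / (2 * n) ≤ Gam P u v} ∪ ((((fun P => (P, w1)) ⁻¹' GamAux.Bad d n) ∪
      ((fun P => (P, w2)) ⁻¹' GamAux.Bad d n)) ∪ (((fun P => (P, w3)) ⁻¹' GamAux.Bad d n) ∪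
      ((fun P => (P, w4)) ⁻¹' GamAux.Bad d n))) := by
    intro P _
    by_contra hc
    simp only [Set.mem_union, not_or] at hc
    exact hc.1 (H P hc.2.1.1 hc.2.1.2 hc.2.2.1 hc.2.2.2)
  have hb := fun w hw => GamAux.conc hd hdn μ hμ w hw
  have hone : 1 ≤ μ {P | (d : ℝ) / (2 * n) ≤ Gam P u v} + 16 * e := by
    rw [← measure_univ (μ := μ)]
    refine (measure_mono hcover).trans ((measure_union_le _ _).trans (add_le_add le_rfl ?_))
    refine (measure_union_le _ _).trans ?_
    refine (add_le_add (measure_union_le _ _) (measure_union_le _ _)).trans ?_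
    refine (add_le_add (add_le_add (hb _ h1) (hb _ h2))
      (add_le_add (hb _ h3) (hb _ h4))).trans (le_of_eq ?_)
    rw [← he]
    ring
  have hε1 : ε ^ 2 ≤ 1 := by
    have := hε2.trans_le (min_le_left _ _)
    nlinarith
  have hee : 16 * e ≤ ENNReal.ofReal (16 * Real.exp (-(1 / 1000 * ε ^ 2 * d))) := by
    rw [ENNReal.ofReal_mul (by norm_num), he]
    norm_num
    gcongr
    have : (0 : ℝ) ≤ d := by positivity
    nlinarith
  rw [ENNReal.ofReal_sub _ (by positivity), ENNReal.ofReal_one]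
  refine tsub_le_iff_right.mpr (hone.trans ?_)
  gcongr
end
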